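/- arXiv:math/0506317 — 2 statements merged into one kernel-verified Lean document; each statement's English description precedes it below -/
import Mathlib

section
/- For every k ≥ 1, the number of staircase polygons of half-perimeter k+1 equals the weighted count Σ_h 2^{L(h)}, where the sum is over all integer sequences h_0, h_1, …, h_k with h_0 = 1, h_k = 0, h_j ≥ 1 for all 0 ≤ j < k, and |h_{j+1} − h_j| ≤ 1 for all 0 ≤ j < k, and L(h) is the number of indices j with h_{j+1} = h_j. (This is the correctness of the gap transfer-matrix algorithm: h_j records the gap between the two walks across the diagonal x + y = j + 1/2, and each level step of the gap arises in exactly two ways.) -/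
/-- A directed lattice path of `n` steps: each step is a unit step east or north. -/
def IsDirectedPath (n : ℕ) (p : Fin (n + 1) → ℤ × ℤ) : Prop :=
  ∀ i : Fin n, p i.succ - p i.castSucc = (1, 0) ∨ p i.succ - p i.castSucc = (0, 1)

/-- `p, q` form a staircase polygon of half-perimeter `n`: two distinct directed paths of
`n` steps, both starting at the origin, ending at the same point, and sharing no
vertices other than their common start and end. -/
def IsStaircasePair (n : ℕ) (p q : Fin (n + 1) → ℤ × ℤ) : Prop :=
  IsDirectedPath n p ∧ IsDirectedPath n q ∧
  p 0 = (0, 0) ∧ q 0 = (0, 0) ∧ p ≠ q ∧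
  p (Fin.last n) = q (Fin.last n) ∧
  ∀ i j : Fin (n + 1), p i = q j →
    (i = 0 ∧ j = 0) ∨ (i = Fin.last n ∧ j = Fin.last n)

/-- The number of staircase polygons of half-perimeter `n`, counted as unordered pairs. -/
noncomputable def staircaseCount (n : ℕ) : ℕ :=
  Nat.card {s : Sym2 (Fin (n + 1) → ℤ × ℤ) //
    ∃ p q, s = s(p, q) ∧ IsStaircasePair n p q}

/-- The `i`-th step of a walk. -/
def walkStep (n : ℕ) (w : Fin (n + 1) → ℤ × ℤ) (i : Fin n) : ℤ × ℤ :=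
  w i.succ - w i.castSucc

/-- The three-choice condition: a step immediately following an east step is east or
north, and a step immediately following a west step is west or south. -/
def ThreeChoiceCond (n : ℕ) (w : Fin (n + 1) → ℤ × ℤ) : Prop :=
  ∀ i j : Fin n, (j : ℕ) = (i : ℕ) + 1 →
    (walkStep n w i = (1, 0) → walkStep n w j = (1, 0) ∨ walkStep n w j = (0, 1)) ∧
    (walkStep n w i = (-1, 0) → walkStep n w j = (-1, 0) ∨ walkStep n w j = (0, -1))

/-- A three-choice walk of `n` steps: a self-avoiding walk on `ℤ²` starting at the
origin with unit steps, satisfying the three-choice condition. -/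
def IsThreeChoiceWalk (n : ℕ) (w : Fin (n + 1) → ℤ × ℤ) : Prop :=
  w 0 = (0, 0) ∧
  (∀ i : Fin n, walkStep n w i ∈ ({(1, 0), (-1, 0), (0, 1), (0, -1)} : Set (ℤ × ℤ))) ∧
  Function.Injective w ∧
  ThreeChoiceCond n w

/-- The number of three-choice walks of `n` steps. -/
noncomputable def threeChoiceWalkCount (n : ℕ) : ℕ :=
  Nat.card {w : Fin (n + 1) → ℤ × ℤ // IsThreeChoiceWalk n w}

/-- A three-choice polygon of perimeter `2n`: a three-choice walk of `2n` steps ending at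
the origin, visiting no vertex twice except that its first vertex equals its last. -/
def IsThreeChoicePolygon (n : ℕ) (w : Fin (2 * n + 1) → ℤ × ℤ) : Prop :=
  w 0 = (0, 0) ∧ w (Fin.last (2 * n)) = (0, 0) ∧
  (∀ i : Fin (2 * n),
    walkStep (2 * n) w i ∈ ({(1, 0), (-1, 0), (0, 1), (0, -1)} : Set (ℤ × ℤ))) ∧
  (∀ i j : Fin (2 * n), w i.castSucc = w j.castSucc → i = j) ∧
  ThreeChoiceCond (2 * n) w

/-- The number of three-choice polygons of perimeter `2n`. -/
noncomputable def threeChoicePolygonCount (n : ℕ) : ℕ :=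
  Nat.card {w : Fin (2 * n + 1) → ℤ × ℤ // IsThreeChoicePolygon n w}

/-- The set of lattice edges traversed by a path of `n` steps. -/
def pathEdges (n : ℕ) (p : Fin (n + 1) → ℤ × ℤ) : Set (Sym2 (ℤ × ℤ)) :=
  {e | ∃ i : Fin n, e = s(p i.castSucc, p i.succ)}

/-- The edge set of a three-choice polygon of perimeter `2n`. -/
def polygonEdges (n : ℕ) (w : Fin (2 * n + 1) → ℤ × ℤ) : Set (Sym2 (ℤ × ℤ)) :=
  {e | ∃ i : Fin (2 * n), e = s(w i.castSucc, w i.succ)}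

/-- Translation of a set of lattice edges by the vector `v`. -/
def translateEdges (v : ℤ × ℤ) (E : Set (Sym2 (ℤ × ℤ))) : Set (Sym2 (ℤ × ℤ)) :=
  (Sym2.map (· + v)) '' E

/-- `E` is the edge set of some staircase polygon. -/
def IsStaircaseEdgeSet (E : Set (Sym2 (ℤ × ℤ))) : Prop :=
  ∃ (n : ℕ) (p q : Fin (n + 1) → ℤ × ℤ),
    IsStaircasePair n p q ∧ E = pathEdges n p ∪ pathEdges n q

/-- `E` is a translate of the edge set of some staircase polygon. -/
def IsStaircaseTranslate (E : Set (Sym2 (ℤ × ℤ))) : Prop :=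
  ∃ (v : ℤ × ℤ) (F : Set (Sym2 (ℤ × ℤ))), IsStaircaseEdgeSet F ∧ E = translateEdges v F

/-- Two edge sets are translation-equivalent. -/
def TransEquiv (E F : Set (Sym2 (ℤ × ℤ))) : Prop :=
  ∃ v : ℤ × ℤ, F = translateEdges v E

/-- The number of imperfect staircase polygons of perimeter `2n`: translation-equivalence
classes of edge sets of three-choice polygons of perimeter `2n` that are not translates of
the edge set of any staircase polygon. -/
noncomputable def imperfectCount (n : ℕ) : ℕ :=
  Nat.card {C : Set (Set (Sym2 (ℤ × ℤ))) //
    ∃ w : Fin (2 * n + 1) → ℤ × ℤ, IsThreeChoicePolygon n w ∧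
      ¬ IsStaircaseTranslate (polygonEdges n w) ∧
      C = {F | TransEquiv (polygonEdges n w) F}}

/-- A gap sequence of length `k`: `h_0 = 1`, `h_k = 0`, `h_j ≥ 1` for `0 ≤ j < k`, and
consecutive values differ by at most `1`. -/
def IsGapSeq (k : ℕ) (h : Fin (k + 1) → ℤ) : Prop :=
  h 0 = 1 ∧ h (Fin.last k) = 0 ∧ (∀ j : Fin k, 1 ≤ h j.castSucc) ∧
  ∀ j : Fin k, |h j.succ - h j.castSucc| ≤ 1

/-- `L(h)`: the number of level steps of the sequence `h`. -/
noncomputable def levelCount (k : ℕ) (h : Fin (k + 1) → ℤ) : ℕ :=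
  Nat.card {j : Fin k // h j.succ = h j.castSucc}

/-- The path of `k + 1` steps from the origin whose first step is `v` and whose later steps are
east at the indices in `E` and north elsewhere. -/
def pathOfSteps {k : ℕ} (v : ℤ × ℤ) (E : Finset (Fin k)) : Fin (k + 2) → ℤ × ℤ :=
  Fin.cases 0 fun i => v + Fin.partialSum (fun j => if j ∈ E then (1, 0) else (0, 1)) i

theorem pathOfSteps_zero {k : ℕ} (v : ℤ × ℤ) (E : Finset (Fin k)) : pathOfSteps v E 0 = 0 := rfl

theorem pathOfSteps_succ_zero {k : ℕ} (v : ℤ × ℤ) (E : Finset (Fin k)) :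
    pathOfSteps v E (Fin.succ 0) = v := by
  simp only [pathOfSteps, Fin.cases_succ, Fin.partialSum_zero, add_zero]

theorem pathOfSteps_succ_succ {k : ℕ} (v : ℤ × ℤ) (E : Finset (Fin k)) (j : Fin k) :
    pathOfSteps v E j.succ.succ =
      pathOfSteps v E j.castSucc.succ + if j ∈ E then (1, 0) else (0, 1) := by
  simp only [pathOfSteps, Fin.cases_succ, Fin.partialSum_succ, add_assoc]

theorem isDirectedPath_pathOfSteps {k : ℕ} {v : ℤ × ℤ} (hv : v = (1, 0) ∨ v = (0, 1))
    (E : Finset (Fin k)) : IsDirectedPath (k + 1) (pathOfSteps v E) := by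
  intro i
  cases i using Fin.cases with
  | zero => rwa [Fin.castSucc_zero, pathOfSteps_succ_zero, pathOfSteps_zero, sub_zero]
  | succ j =>
    rw [← Fin.succ_castSucc, pathOfSteps_succ_succ, add_sub_cancel_left]
    split_ifs <;> simp

theorem pathOfSteps_injective {k : ℕ} (v : ℤ × ℤ) :
    Function.Injective (pathOfSteps (k := k) v) := by
  intro E F h
  ext j
  have h1 := pathOfSteps_succ_succ v E j
  rw [h, pathOfSteps_succ_succ v F j] at h1
  have h2 := add_left_cancel h1
  split_ifs at h2 <;> simp_all

theorem IsDirectedPath.eq_pathOfSteps {k : ℕ} {p : Fin (k + 2) → ℤ × ℤ}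
    (hp : IsDirectedPath (k + 1) p) (h0 : p 0 = 0) :
    p = pathOfSteps (p (Fin.succ 0))
      {j | p j.succ.succ - p j.castSucc.succ = (1, 0)} := by
  funext i
  cases i using Fin.cases with
  | zero => rw [h0, pathOfSteps_zero]
  | succ i =>
    induction i using Fin.induction with
    | zero => rw [pathOfSteps_succ_zero]
    | succ j ih =>
      rw [pathOfSteps_succ_succ, ← ih, ← sub_eq_iff_eq_add']
      have := hp j.succ
      rw [← Fin.succ_castSucc] at this
      simp only [Finset.mem_filter, Finset.mem_univ, true_and]
      split_ifs with h
      · exact h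
      · exact this.resolve_left h

theorem IsDirectedPath.fst_add_snd {n : ℕ} {p : Fin (n + 1) → ℤ × ℤ}
    (hp : IsDirectedPath n p) (h0 : p 0 = (0, 0)) (i : Fin (n + 1)) :
    (p i).1 + (p i).2 = (i : ℕ) := by
  induction i using Fin.induction with
  | zero => simp [h0]
  | succ j ih =>
    have := hp j
    simp only [Prod.ext_iff, Prod.fst_sub, Prod.snd_sub] at this
    simp only [Fin.val_castSucc, Fin.val_succ, Nat.cast_add, Nat.cast_one] at ih ⊢
    omega

theorem IsDirectedPath.index_eq {n : ℕ} {p q : Fin (n + 1) → ℤ × ℤ}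
    (hp : IsDirectedPath n p) (hq : IsDirectedPath n q) (hp0 : p 0 = (0, 0)) (hq0 : q 0 = (0, 0))
    {i j : Fin (n + 1)} (h : p i = q j) : i = j := by
  have h1 := hp.fst_add_snd hp0 i
  rw [h, hq.fst_add_snd hq0 j] at h1
  exact Fin.ext (by exact_mod_cast h1.symm)

theorem IsStaircasePair.symm {n : ℕ} {p q : Fin (n + 1) → ℤ × ℤ} (h : IsStaircasePair n p q) :
    IsStaircasePair n q p := by
  obtain ⟨hp, hq, hp0, hq0, hne, hl, hd⟩ := h
  exact ⟨hq, hp, hq0, hp0, hne.symm, hl.symm, fun i j hij =>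
    (hd j i hij.symm).imp And.symm And.symm⟩

/-- The indices at which `h` increases. -/
def rises {k : ℕ} (h : Fin (k + 1) → ℤ) : Finset (Fin k) := {j | h j.castSucc < h j.succ}

/-- The indices at which `h` decreases. -/
def falls {k : ℕ} (h : Fin (k + 1) → ℤ) : Finset (Fin k) := {j | h j.succ < h j.castSucc}

/-- The indices at which `h` is level. -/
def levels {k : ℕ} (h : Fin (k + 1) → ℤ) : Finset (Fin k) := {j | h j.succ = h j.castSucc}

theorem levelCount_eq_card_levels {k : ℕ} (h : Fin (k + 1) → ℤ) :
    levelCount k h = (levels h).card := by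
  rw [levelCount, Nat.card_eq_fintype_card, Fintype.card_subtype, levels]

/-- The lower path of the polygon with gap sequence `h` in which both paths go east at the level
steps in `S`. -/
def lowerPath {k : ℕ} (h : Fin (k + 1) → ℤ) (S : Finset (Fin k)) : Fin (k + 2) → ℤ × ℤ :=
  pathOfSteps (1, 0) (rises h ∪ S)

/-- The upper path of the polygon with gap sequence `h` in which both paths go east at the level
steps in `S`. -/
def upperPath {k : ℕ} (h : Fin (k + 1) → ℤ) (S : Finset (Fin k)) : Fin (k + 2) → ℤ × ℤ :=
  pathOfSteps (0, 1) (falls h ∪ S)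

theorem lowerPath_sub_upperPath {k : ℕ} {h : Fin (k + 1) → ℤ} (hh : IsGapSeq k h)
    {S : Finset (Fin k)} (hS : S ⊆ levels h) (i : Fin (k + 1)) :
    (lowerPath h S i.succ).1 - (upperPath h S i.succ).1 = h i := by
  obtain ⟨h0, -, -, hd⟩ := hh
  induction i using Fin.induction with
  | zero => simp only [lowerPath, upperPath, pathOfSteps_succ_zero, h0, sub_zero]
  | succ j ih =>
    have hj := abs_le.mp (hd j)
    have hSj : j ∈ S → h j.succ = h j.castSucc := fun hj => by simpa [levels] using hS hj
    rw [lowerPath, upperPath] at ih ⊢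
    rw [pathOfSteps_succ_succ, pathOfSteps_succ_succ, Prod.fst_add, Prod.fst_add]
    simp only [Finset.mem_union]
    have hr : j ∈ rises h ↔ h j.castSucc < h j.succ := by simp [rises]
    have hf : j ∈ falls h ↔ h j.succ < h j.castSucc := by simp [falls]
    by_cases hjS : j ∈ S
    · simp only [hjS, or_true, if_true]
      have := hSj hjS
      omega
    · simp only [hjS, or_false, hr, hf]
      split_ifs <;> simp only <;> omega

theorem isStaircasePair_lowerPath_upperPath {k : ℕ} {h : Fin (k + 1) → ℤ} (hh : IsGapSeq k h)
    {S : Finset (Fin k)} (hS : S ⊆ levels h) :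
    IsStaircasePair (k + 1) (lowerPath h S) (upperPath h S) := by
  have hp : IsDirectedPath (k + 1) (lowerPath h S) := isDirectedPath_pathOfSteps (by simp) _
  have hq : IsDirectedPath (k + 1) (upperPath h S) := isDirectedPath_pathOfSteps (by simp) _
  have hgap := lowerPath_sub_upperPath hh hS
  obtain ⟨h0, hl, hpos, -⟩ := hh
  refine ⟨hp, hq, rfl, rfl, fun he => ?_, ?_, fun i j hij => ?_⟩
  · have := hgap 0
    rw [he, h0, sub_self] at this
    omega
  · have h1 := hgap (Fin.last k)
    have h2 := hp.fst_add_snd rfl (Fin.last k).succ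
    have h3 := hq.fst_add_snd rfl (Fin.last k).succ
    rw [hl] at h1
    rw [← Fin.succ_last]
    exact Prod.ext (by omega) (by omega)
  · obtain rfl := hp.index_eq hq rfl rfl hij
    cases i using Fin.cases with
    | zero => simp
    | succ i =>
      have h1 := hgap i
      rw [hij, sub_self] at h1
      cases i using Fin.lastCases with
      | last => simp
      | cast i =>
        have := hpos i
        omega

theorem IsStaircasePair.exists_gap {k : ℕ} (hk : 1 ≤ k) {p q : Fin (k + 2) → ℤ × ℤ}
    (hpq : IsStaircasePair (k + 1) p q) (hp1 : p (Fin.succ 0) = (1, 0)) :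
    ∃ (h : Fin (k + 1) → ℤ) (S : Finset (Fin k)), IsGapSeq k h ∧ S ⊆ levels h ∧
      lowerPath h S = p ∧ upperPath h S = q := by
  obtain ⟨hp, hq, hp0, hq0, -, hl, hd⟩ := hpq
  have hq1 : q (Fin.succ 0) = (0, 1) := by
    have h1 := hq 0
    rw [Fin.castSucc_zero, hq0, ← Prod.zero_eq_mk, sub_zero] at h1
    refine h1.resolve_left fun h2 => ?_
    have := hd _ _ (hp1.trans h2.symm)
    simp only [Fin.ext_iff, Fin.val_succ, Fin.val_zero, Fin.val_last] at this
    omega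
  set E : Finset (Fin k) := {j | p j.succ.succ - p j.castSucc.succ = (1, 0)}
  set F : Finset (Fin k) := {j | q j.succ.succ - q j.castSucc.succ = (1, 0)}
  have hpE : p = pathOfSteps (1, 0) E := hp1 ▸ hp.eq_pathOfSteps hp0
  have hqF : q = pathOfSteps (0, 1) F := hq1 ▸ hq.eq_pathOfSteps hq0
  set h : Fin (k + 1) → ℤ := fun i => (p i.succ).1 - (q i.succ).1 with hh
  have h0 : h 0 = 1 := by simp only [hh, hp1, hq1, sub_zero]
  have hstep (j : Fin k) : h j.succ =
      h j.castSucc + (if j ∈ E then 1 else 0) - (if j ∈ F then 1 else 0) := by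
    simp only [hh]
    rw [hpE, hqF, pathOfSteps_succ_succ, pathOfSteps_succ_succ, Prod.fst_add, Prod.fst_add]
    split_ifs <;> simp only <;> ring
  have hne (j : Fin k) : h j.castSucc ≠ 0 := by
    intro hz
    have h2 := hp.fst_add_snd hp0 j.castSucc.succ
    have h3 := hq.fst_add_snd hq0 j.castSucc.succ
    simp only [hh] at hz
    have := hd j.castSucc.succ j.castSucc.succ (Prod.ext (by omega) (by omega))
    simp only [Fin.ext_iff, Fin.val_succ, Fin.val_zero, Fin.val_last, Fin.val_castSucc] at this
    omega
  have hnonneg (i : Fin (k + 1)) : 0 ≤ h i := by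
    induction i using Fin.induction with
    | zero => omega
    | succ j ih =>
      have := hne j
      have := hstep j
      split_ifs at this <;> omega
  refine ⟨h, E ∩ F, ⟨h0, ?_, fun j => ?_, fun j => ?_⟩, fun j hj => ?_, ?_, ?_⟩
  · simp only [hh, Fin.succ_last, hl, sub_self]
  · have := hne j
    have := hnonneg j.castSucc
    omega
  · rw [abs_le, hstep j]
    split_ifs <;> omega
  · rw [Finset.mem_inter] at hj
    have := hstep j
    simpa [levels, hj] using this
  · rw [lowerPath, hpE]
    congr 1
    ext j
    have := hstep j
    simp only [rises, Finset.mem_union, Finset.mem_inter, Finset.mem_filter_univ]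
    clear_value h E F
    grind
  · rw [upperPath, hqF]
    congr 1
    ext j
    have := hstep j
    simp only [falls, Finset.mem_union, Finset.mem_inter, Finset.mem_filter_univ]
    clear_value h E F
    grind

theorem setOf_isGapSeq_finite (k : ℕ) : {h | IsGapSeq k h}.Finite := by
  refine (Set.finite_Icc (fun _ => 0) (fun _ => (k : ℤ) + 1)).subset ?_
  rintro h ⟨h0, hl, hpos, hd⟩
  have hle (i : Fin (k + 1)) : h i ≤ (i : ℕ) + 1 := by
    induction i using Fin.induction with
    | zero => simp [h0]
    | succ j ih =>
      have := abs_le.mp (hd j)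
      simp only [Fin.val_castSucc, Fin.val_succ, Nat.cast_add, Nat.cast_one] at ih ⊢
      omega
  refine ⟨fun i => ?_, fun i => ?_⟩
  · cases i using Fin.lastCases with
    | last => exact hl.ge
    | cast j => exact zero_le_one.trans (hpos j)
  · have := hle i
    have := i.is_lt
    simp only
    omega

/-- For every `k ≥ 1`, the number of staircase polygons of half-perimeter `k + 1` equals
the weighted count `Σ_h 2^{L(h)}` over all gap sequences `h` of length `k`. -/
theorem staircaseCount_eq_gap_sum (k : ℕ) (hk : 1 ≤ k) :
    staircaseCount (k + 1) =
      ∑ᶠ (h : Fin (k + 1) → ℤ) (_ : IsGapSeq k h), 2 ^ levelCount k h := by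
  have hfin := setOf_isGapSeq_finite k
  let T : Finset (Σ _ : Fin (k + 1) → ℤ, Finset (Fin k)) :=
    hfin.toFinset.sigma fun h => (levels h).powerset
  have hT (x : Σ _ : Fin (k + 1) → ℤ, Finset (Fin k)) :
      x ∈ T ↔ IsGapSeq k x.1 ∧ x.2 ⊆ levels x.1 := by
    simp [T]
  have hsum : ∑ᶠ (h : Fin (k + 1) → ℤ) (_ : IsGapSeq k h), 2 ^ levelCount k h = T.card := by
    rw [Finset.card_sigma]
    refine (finsum_mem_eq_finite_toFinset_sum _ hfin).trans (Finset.sum_congr rfl fun h _ => ?_)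
    rw [Finset.card_powerset, levelCount_eq_card_levels]
  let G : (Σ _ : Fin (k + 1) → ℤ, Finset (Fin k)) → Sym2 (Fin (k + 2) → ℤ × ℤ) :=
    fun x => s(lowerPath x.1 x.2, upperPath x.1 x.2)
  have hinj : Set.InjOn G T := by
    rintro ⟨h, S⟩ hx ⟨h', S'⟩ hx' heq
    obtain ⟨hh, hS⟩ := (hT _).mp hx
    obtain ⟨hh', hS'⟩ := (hT _).mp hx'
    dsimp only at hh hS hh' hS'
    rcases Sym2.eq_iff.mp heq with ⟨hl, hu⟩ | ⟨hl, -⟩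
    · dsimp only at hl hu
      obtain rfl : h = h' := by
        funext i
        rw [← lowerPath_sub_upperPath hh hS, ← lowerPath_sub_upperPath hh' hS', hl, hu]
      have hr := pathOfSteps_injective _ hl
      have hdisj {U : Finset (Fin k)} (hU : U ⊆ levels h) : Disjoint (rises h) U := by
        refine Finset.disjoint_left.mpr fun j hj hjU => ?_
        have := hU hjU
        simp only [rises, levels, Finset.mem_filter_univ] at hj this
        omega
      rw [← Finset.union_sdiff_cancel_left (hdisj hS), hr,
        Finset.union_sdiff_cancel_left (hdisj hS')]
    · have := congrFun hl (Fin.succ 0)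
      simp only [lowerPath, upperPath, pathOfSteps_succ_zero] at this
      exact absurd this (by decide)
  have himage : {s : Sym2 (Fin (k + 2) → ℤ × ℤ) |
      ∃ p q, s = s(p, q) ∧ IsStaircasePair (k + 1) p q} = G '' T := by
    ext s
    constructor
    · rintro ⟨p, q, rfl, hpq⟩
      wlog hp1 : p (Fin.succ 0) = (1, 0) generalizing p q with H
      · rw [Sym2.eq_swap]
        refine H q p hpq.symm ?_
        obtain ⟨hp, hq, hp0, hq0, -, -, hd⟩ := hpq
        have h1 := hp 0
        have h2 := hq 0
        rw [Fin.castSucc_zero, hp0, ← Prod.zero_eq_mk, sub_zero] at h1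
        rw [Fin.castSucc_zero, hq0, ← Prod.zero_eq_mk, sub_zero] at h2
        refine h2.resolve_right fun h3 => ?_
        have := hd _ _ ((h1.resolve_left hp1).trans h3.symm)
        simp only [Fin.ext_iff, Fin.val_succ, Fin.val_zero, Fin.val_last] at this
        omega
      · obtain ⟨h, S, hh, hS, rfl, rfl⟩ := hpq.exists_gap hk hp1
        exact ⟨⟨h, S⟩, (hT _).mpr ⟨hh, hS⟩, rfl⟩
    · rintro ⟨⟨h, S⟩, hx, rfl⟩
      obtain ⟨hh, hS⟩ := (hT _).mp hx
      exact ⟨_, _, rfl, isStaircasePair_lowerPath_upperPath hh hS⟩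
  rw [hsum, ← Set.ncard_coe_finset, ← hinj.ncard_image, ← himage]
  rfl
end

section
/- For every k ≥ 1, Σ_h 2^{L(h)} = (1/(k+1))·binom(2k, k), where the sum is over all integer sequences h_0, h_1, …, h_k with h_0 = 1, h_k = 0, h_j ≥ 1 for all 0 ≤ j < k, and |h_{j+1} − h_j| ≤ 1 for all 0 ≤ j < k, and L(h) is the number of indices j with h_{j+1} = h_j. -/
/-- The sequences of length `k` from height `m` to height `0` which are positive before the last
index and whose consecutive values differ by at most `1`. -/
def gapSeqFrom (k : ℕ) (m : ℤ) : Set (Fin (k + 1) → ℤ) :=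
  {h | h 0 = m ∧ h (Fin.last k) = 0 ∧ (∀ j : Fin k, 1 ≤ h j.castSucc) ∧
    ∀ j : Fin k, |h j.succ - h j.castSucc| ≤ 1}

/-- The sum of `2 ^ levelCount k h` over `gapSeqFrom k m`, computed by splitting off the first
step. -/
def gapWeight : ℕ → ℕ → ℕ
  | 0, 0 => 1
  | 0, _ + 1 => 0
  | _ + 1, 0 => 0
  | k + 1, m + 1 => gapWeight k m + 2 * gapWeight k (m + 1) + gapWeight k (m + 2)

theorem gapWeight_add_choose (n m : ℕ) :
    gapWeight (n + 1) m + (2 * n + 1).choose (n + m + 1) = (2 * n + 1).choose (n + m) := by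
  induction n generalizing m with
  | zero =>
    rcases m with _ | _ | m
    · simp [gapWeight]
    · simp [gapWeight]
    · simp [gapWeight, Nat.choose_eq_zero_of_lt]
  | succ n ih =>
    rcases m with _ | m
    · have := Nat.choose_symm_half (n + 1)
      simpa [gapWeight] using this
    · have h₀ := ih m
      have h₁ := ih (m + 1)
      have h₂ := ih (m + 2)
      have pascal (j : ℕ) : (2 * (n + 1) + 1).choose (j + 2) =
          (2 * n + 1).choose j + 2 * (2 * n + 1).choose (j + 1) + (2 * n + 1).choose (j + 2) := by
        rw [show 2 * (n + 1) + 1 = 2 * n + 1 + 1 + 1 by ring]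
        simp only [Nat.choose_succ_succ']
        ring
      rw [gapWeight, show n + 1 + (m + 1) + 1 = n + m + 1 + 2 by ring,
        show n + 1 + (m + 1) = n + m + 2 by ring, pascal, pascal]
      simp only [← add_assoc] at *
      simp only [add_assoc, Nat.reduceAdd] at *
      omega

theorem gapWeight_one (n : ℕ) : gapWeight (n + 1) 1 = catalan (n + 1) := by
  have h := gapWeight_add_choose n 1
  have h₁ := Nat.choose_succ_right_eq (2 * n + 1) (n + 1)
  have h₂ := Nat.choose_symm_half n
  have h₃ := succ_mul_catalan_eq_centralBinom (n + 1)
  rw [Nat.centralBinom, show 2 * (n + 1) = 2 * n + 1 + 1 by ring, Nat.choose_succ_succ', ← h₂] at h₃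
  rw [show 2 * n + 1 - (n + 1) = n by omega] at h₁
  apply Nat.eq_of_mul_eq_mul_left (show 0 < n + 1 + 1 by omega)
  rw [h₃]
  nlinarith

theorem levelCount_cons (k : ℕ) (m : ℤ) (h : Fin (k + 1) → ℤ) :
    levelCount (k + 1) (Fin.cons m h : Fin (k + 2) → ℤ) =
      (if h 0 = m then 1 else 0) + levelCount k h := by
  classical
  simp only [levelCount, Nat.card_eq_fintype_card, Fintype.card_subtype, Finset.card_filter]
  rw [Fin.sum_univ_succ]
  simp

theorem gapSeqFrom_zero (m : ℕ) : gapSeqFrom 0 m = {h | h = 0 ∧ m = 0} := by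
  ext h
  simp only [gapSeqFrom, Set.mem_ofPred_eq, IsEmpty.forall_iff, and_true, funext_iff,
    Fin.forall_fin_succ, Fin.last_zero, Pi.zero_apply]
  omega

theorem gapSeqFrom_succ_zero (k : ℕ) : gapSeqFrom (k + 1) 0 = ∅ := by
  ext h
  simp only [gapSeqFrom, Set.mem_ofPred_eq, Set.mem_empty_iff_false, iff_false]
  rintro ⟨h₀, -, hpos, -⟩
  have := hpos 0
  simp [h₀] at this

theorem gapSeqFrom_succ (k : ℕ) {m : ℤ} (hm : 1 ≤ m) :
    gapSeqFrom (k + 1) m = (fun h : Fin (k + 1) → ℤ => (Fin.cons m h : Fin (k + 2) → ℤ)) ''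
      (gapSeqFrom k (m - 1) ∪ gapSeqFrom k m ∪ gapSeqFrom k (m + 1)) := by
  ext h
  induction h using Fin.consCases with
  | cons a h =>
    simp only [Set.mem_image, Fin.cons_inj, gapSeqFrom, Set.mem_ofPred_eq, Set.mem_union,
      Fin.forall_fin_succ (n := k), ← Fin.succ_last, Fin.cons_succ, Fin.cons_zero,
      Fin.castSucc_zero, Fin.castSucc_succ, abs_le]
    constructor
    · rintro ⟨rfl, h₁, ⟨-, h₂⟩, h₃, h₄⟩
      refine ⟨h, ?_, rfl, rfl⟩
      simp only [h₁, true_and]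
      have : h 0 = a - 1 ∨ h 0 = a ∨ h 0 = a + 1 := by omega
      tauto
    · rintro ⟨h, h', rfl, rfl⟩
      have : -1 ≤ h 0 - m ∧ h 0 - m ≤ 1 := by
        rcases h' with (h' | h') | h' <;> omega
      tauto

theorem finite_gapSeqFrom (k m : ℕ) : (gapSeqFrom k m).Finite := by
  induction k generalizing m with
  | zero =>
    rw [gapSeqFrom_zero]
    exact (Set.finite_singleton 0).subset fun h hh => hh.1
  | succ k ih =>
    rcases m with _ | m
    · simp [gapSeqFrom_succ_zero]
    · rw [gapSeqFrom_succ k (by omega)]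
      rw [show ((m + 1 : ℕ) : ℤ) - 1 = m by simp,
        show ((m + 1 : ℕ) : ℤ) + 1 = (m + 2 : ℕ) by push_cast; ring]
      exact (((ih m).union (ih (m + 1))).union (ih (m + 2))).image _

theorem disjoint_gapSeqFrom (k : ℕ) {a b : ℤ} (hab : a ≠ b) :
    Disjoint (gapSeqFrom k a) (gapSeqFrom k b) :=
  Set.disjoint_left.2 fun _ ha hb => hab (ha.1.symm.trans hb.1)

theorem finsum_gapSeqFrom_succ (k : ℕ) (m : ℕ) :
    ∑ᶠ h ∈ gapSeqFrom (k + 1) (m + 1 : ℕ), 2 ^ levelCount (k + 1) h =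
      ∑ᶠ h ∈ gapSeqFrom k m, 2 ^ levelCount k h +
        2 * ∑ᶠ h ∈ gapSeqFrom k (m + 1 : ℕ), 2 ^ levelCount k h +
        ∑ᶠ h ∈ gapSeqFrom k (m + 2 : ℕ), 2 ^ levelCount k h := by
  have hd {a b : ℕ} (hab : a ≠ b) : Disjoint (gapSeqFrom k a) (gapSeqFrom k b) :=
    disjoint_gapSeqFrom k (by exact_mod_cast hab)
  rw [gapSeqFrom_succ k (by omega), finsum_mem_image fun _ _ _ _ h => Fin.cons_right_injective _ h,
    show ((m + 1 : ℕ) : ℤ) - 1 = m by simp,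
    show ((m + 1 : ℕ) : ℤ) + 1 = (m + 2 : ℕ) by push_cast; ring,
    finsum_mem_union (Set.disjoint_union_left.2 ⟨hd (by omega), hd (by omega)⟩)
      ((finite_gapSeqFrom k _).union (finite_gapSeqFrom k _)) (finite_gapSeqFrom k _),
    finsum_mem_union (hd (by omega)) (finite_gapSeqFrom k _) (finite_gapSeqFrom k _),
    mul_finsum_mem]
  congr 1
  · congr 1 <;> refine finsum_mem_congr rfl fun h hh => ?_
    · rw [levelCount_cons, if_neg (by rw [hh.1]; omega), zero_add]
    · rw [levelCount_cons, if_pos hh.1, pow_add, pow_one]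
  · refine finsum_mem_congr rfl fun h hh => ?_
    rw [levelCount_cons, if_neg (by rw [hh.1]; omega), zero_add]

theorem finsum_gapSeqFrom (k m : ℕ) :
    ∑ᶠ h ∈ gapSeqFrom k m, 2 ^ levelCount k h = gapWeight k m := by
  induction k generalizing m with
  | zero =>
    rw [gapSeqFrom_zero]
    rcases m with _ | m
    · simp [gapWeight, levelCount]
    · simp [gapWeight]
  | succ k ih =>
    rcases m with _ | m
    · simp [gapSeqFrom_succ_zero, gapWeight]
    · rw [finsum_gapSeqFrom_succ, ih, ih, ih, gapWeight]

/-- For every `k ≥ 1`, `Σ_h 2^{L(h)} = (1/(k+1))·binom(2k, k)`, the `k`-th Catalan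
number, where the sum is over all gap sequences `h` of length `k`. -/
theorem gap_sum_eq_catalan (k : ℕ) (hk : 1 ≤ k) :
    ((∑ᶠ (h : Fin (k + 1) → ℤ) (_ : IsGapSeq k h), 2 ^ levelCount k h : ℕ) : ℚ) =
      (1 / (k + 1)) * (Nat.choose (2 * k) k : ℚ) := by
  obtain ⟨n, rfl⟩ := Nat.exists_eq_succ_of_ne_zero (by omega : k ≠ 0)
  have h₁ : ∑ᶠ (h : Fin (n + 1 + 1) → ℤ) (_ : IsGapSeq (n + 1) h), 2 ^ levelCount (n + 1) h =
      catalan (n + 1) :=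
    (finsum_gapSeqFrom (n + 1) 1).trans (gapWeight_one n)
  have h₂ : (((n + 1 + 1) * catalan (n + 1) : ℕ) : ℚ) = (2 * (n + 1)).choose (n + 1) := by
    rw [succ_mul_catalan_eq_centralBinom, Nat.centralBinom]
  rw [Nat.succ_eq_add_one, h₁, ← h₂]
  push_cast
  field_simp
end
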